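/- arXiv:2604.22488 — 3 statements merged into one kernel-verified Lean document; each statement's English description precedes it below -/
import Mathlib

section
/- Let 𝓜 be a nonempty subset of 𝔖 bounded from below. Then: (i) for every L ∈ 𝔏(𝓜) there exists a maximal element M of 𝔏(𝓜) with L ≤ M; in particular Max 𝔏(𝓜) is nonempty; (ii) Max 𝔏(𝓜) is a singleton if and only if inf 𝓜 exists, and in that case Max 𝔏(𝓜) = {inf 𝓜}. -/
noncomputable section

variable {H : Type*} [NormedAddCommGroup H] [InnerProductSpace ℂ H] [CompleteSpace H]

/-- The (real) value `(Su, u)` of the quadratic form of a bounded operator `S`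
(for self-adjoint `S` the inner product `⟪Su, u⟫` is real, and equals this value). -/
def qform (S : H →L[ℂ] H) (u : H) : ℝ := (inner ℂ (S u) u : ℂ).re

/-- Löwner's partial order on bounded self-adjoint operators:
`S ≤ T` iff `(Su,u) ≤ (Tu,u)` for all `u ∈ H`. -/
def LoewnerLE (S T : H →L[ℂ] H) : Prop := ∀ u : H, qform S u ≤ qform T u

/-- The set `𝔏(𝓜)` of lower bounds of `M` within the bounded self-adjoint operators. -/
def lowerBoundsSA (M : Set (H →L[ℂ] H)) : Set (H →L[ℂ] H) :=
  {L | IsSelfAdjoint L ∧ ∀ A ∈ M, LoewnerLE L A}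

/-- `G` is the greatest element of the set `L` with respect to Löwner's order. -/
def IsGreatestSA (L : Set (H →L[ℂ] H)) (G : H →L[ℂ] H) : Prop :=
  G ∈ L ∧ ∀ X ∈ L, LoewnerLE X G

/-- `M` is a maximal element of the set `L` with respect to Löwner's order. -/
def IsMaximalSA (L : Set (H →L[ℂ] H)) (M : H →L[ℂ] H) : Prop :=
  M ∈ L ∧ ∀ X ∈ L, LoewnerLE M X → X = M

theorem loewner_iff {S T : H →L[ℂ] H} (hS : IsSelfAdjoint S) (hT : IsSelfAdjoint T) :
    LoewnerLE S T ↔ S ≤ T := by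
  rw [ContinuousLinearMap.le_def, ContinuousLinearMap.isPositive_def']
  constructor
  · intro h
    refine ⟨hT.sub hS, fun u => ?_⟩
    have := h u
    simp only [qform] at this
    simp [ContinuousLinearMap.reApplyInnerSelf, inner_sub_left]
    exact this
  · rintro ⟨_, h⟩ u
    have := h u
    simp [ContinuousLinearMap.reApplyInnerSelf, inner_sub_left] at this
    exact this

/-- A bounded family of operators converges weakly along an ultrafilter. -/
theorem ultra_limit {ι : Type*} (F : Ultrafilter ι) (T : ι → H →L[ℂ] H) (K : ℝ)
    (hK : ∀ᶠ i in (F : Filter ι), ‖T i‖ ≤ K) :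
    ∃ B : H →L[ℂ] H, ∀ u v, Filter.Tendsto (fun i => (inner ℂ (T i u) v : ℂ)) F
      (nhds (inner ℂ (B u) v)) := by
  have hb : ∀ u v, ∀ᶠ i in (F : Filter ι), ‖(inner ℂ (T i u) v : ℂ)‖ ≤ K * ‖u‖ * ‖v‖ := by
    intro u v
    filter_upwards [hK] with i hi
    calc ‖(inner ℂ (T i u) v : ℂ)‖ ≤ ‖T i u‖ * ‖v‖ := norm_inner_le_norm _ _
      _ ≤ K * ‖u‖ * ‖v‖ := by
        gcongr
        exact (T i).le_of_opNorm_le hi u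
  have hex : ∀ u v, ∃ z : ℂ, ‖z‖ ≤ K * ‖u‖ * ‖v‖ ∧
      Filter.Tendsto (fun i => (inner ℂ (T i u) v : ℂ)) F (nhds z) := by
    intro u v
    have hc := isCompact_closedBall (0 : ℂ) (K * ‖u‖ * ‖v‖)
    obtain ⟨z, hz, hz'⟩ := hc.ultrafilter_le_nhds
      (F.map (fun i => (inner ℂ (T i u) v : ℂ))) (by
        rw [Filter.le_principal_iff, Ultrafilter.coe_map, Filter.mem_map]
        filter_upwards [hb u v] with i hi
        simpa using hi)
    exact ⟨z, by simpa using hz, hz'⟩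
  choose b hbn hbt using hex
  let B₀ : H →ₗ⋆[ℂ] H →ₗ[ℂ] ℂ := LinearMap.mk₂'ₛₗ (starRingEnd ℂ) (RingHom.id ℂ) b
    (fun u u' v => tendsto_nhds_unique (hbt _ _)
      (((hbt u v).add (hbt u' v)).congr fun i => by simp))
    (fun c u v => tendsto_nhds_unique (hbt _ _)
      (((hbt u v).const_mul (starRingEnd ℂ c)).congr fun i => by simp [mul_comm]))
    (fun u v v' => tendsto_nhds_unique (hbt _ _)
      (((hbt u v).add (hbt u v')).congr fun i => by simp))
    (fun c u v => tendsto_nhds_unique (hbt _ _)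
      (((hbt u v).const_mul c).congr fun i => by simp))
  let B₁ : H →L⋆[ℂ] H →L[ℂ] ℂ := B₀.mkContinuous₂ K (fun u v => hbn u v)
  refine ⟨InnerProductSpace.continuousLinearMapOfBilin B₁, fun u v => ?_⟩
  rw [InnerProductSpace.continuousLinearMapOfBilin_apply]
  exact hbt u v

theorem chain_ub (M : Set (H →L[ℂ] H)) (hne : M.Nonempty)
    (hsa : ∀ A ∈ M, IsSelfAdjoint A) (c : Set (H →L[ℂ] H)) (hcM : c ⊆ lowerBoundsSA M)
    (hc : IsChain (· ≤ ·) c) (y : H →L[ℂ] H) (hy : y ∈ c) :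
    ∃ ub ∈ lowerBoundsSA M, ∀ z ∈ c, z ≤ ub := by
  obtain ⟨A, hA⟩ := hne
  have hdir : IsDirected c (· ≤ ·) := ⟨fun a b => by
    rcases hc.total a.2 b.2 with h | h
    · exact ⟨b, h, le_rfl⟩
    · exact ⟨a, le_rfl, h⟩⟩
  have : Nonempty c := ⟨⟨y, hy⟩⟩
  let F : Ultrafilter c := Ultrafilter.of Filter.atTop
  have hF : (F : Filter c) ≤ Filter.atTop := Ultrafilter.of_le _
  have hge : ∀ z : c, ∀ᶠ i in (F : Filter c), z ≤ i := fun z =>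
    hF (Filter.eventually_ge_atTop z)
  obtain ⟨B, hB⟩ := ultra_limit F (fun i : c => (i : H →L[ℂ] H)) (‖A - y‖ + ‖y‖) (by
    filter_upwards [hge ⟨y, hy⟩] with i hi
    have hi' : y ≤ (i : H →L[ℂ] H) := hi
    have h1 : (i : H →L[ℂ] H) ≤ A :=
      (loewner_iff (hcM i.2).1 (hsa A hA)).1 ((hcM i.2).2 A hA)
    have h2 : ‖(i : H →L[ℂ] H) - y‖ ≤ ‖A - y‖ :=
      CStarAlgebra.norm_le_norm_of_nonneg_of_le (sub_nonneg.2 hi') (sub_le_sub_right h1 y)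
    calc ‖(i : H →L[ℂ] H)‖ = ‖((i : H →L[ℂ] H) - y) + y‖ := by rw [sub_add_cancel]
      _ ≤ ‖(i : H →L[ℂ] H) - y‖ + ‖y‖ := norm_add_le _ _
      _ ≤ _ := by gcongr)
  have hBsa : IsSelfAdjoint B := by
    rw [ContinuousLinearMap.isSelfAdjoint_iff_isSymmetric]
    intro u v
    have h1 := hB u v
    have h2 := (Complex.continuous_conj.tendsto _).comp (hB v u)
    simp only [Function.comp_def, inner_conj_symm] at h2
    refine tendsto_nhds_unique h1 (h2.congr fun i => ?_)
    exact (((ContinuousLinearMap.isSelfAdjoint_iff_isSymmetric).1 (hcM i.2).1) u v).symm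
  have hq : ∀ u, Filter.Tendsto (fun i : c => qform (i : H →L[ℂ] H) u) F (nhds (qform B u)) :=
    fun u => (Complex.continuous_re.tendsto _).comp (hB u u)
  refine ⟨B, ⟨hBsa, fun A' hA' u => ?_⟩, fun z hz => ?_⟩
  · exact le_of_tendsto (hq u) (Filter.Eventually.of_forall fun i => (hcM i.2).2 A' hA' u)
  · rw [← loewner_iff (hcM hz).1 hBsa]
    intro u
    refine ge_of_tendsto (hq u) ?_
    filter_upwards [hge ⟨z, hz⟩] with i hi
    exact (loewner_iff (hcM hz).1 (hcM i.2).1).2 hi u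

/-- Theorem 2.1 of the paper: (i) every lower bound of `M` lies below some maximal lower
bound, in particular maximal lower bounds exist; (ii) the set of maximal lower bounds is a
singleton iff the infimum (greatest lower bound) of `M` exists, in which case it is
`{inf M}`. -/
theorem stmt1 (M : Set (H →L[ℂ] H)) (hne : M.Nonempty)
    (hsa : ∀ A ∈ M, IsSelfAdjoint A)
    (hbdd : (lowerBoundsSA M).Nonempty) :
    (∀ L ∈ lowerBoundsSA M, ∃ Mx, IsMaximalSA (lowerBoundsSA M) Mx ∧ LoewnerLE L Mx) ∧
    {X | IsMaximalSA (lowerBoundsSA M) X}.Nonempty ∧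
    ((∃ Mx, {X | IsMaximalSA (lowerBoundsSA M) X} = {Mx}) ↔
      ∃ G, IsGreatestSA (lowerBoundsSA M) G) ∧
    (∀ G, IsGreatestSA (lowerBoundsSA M) G →
      {X | IsMaximalSA (lowerBoundsSA M) X} = {G}) := by
  have hanti : ∀ X ∈ lowerBoundsSA M, ∀ Y ∈ lowerBoundsSA M,
      LoewnerLE X Y → LoewnerLE Y X → X = Y := fun X hX Y hY h1 h2 =>
    le_antisymm ((loewner_iff hX.1 hY.1).1 h1) ((loewner_iff hY.1 hX.1).1 h2)
  have h1 : ∀ L ∈ lowerBoundsSA M, ∃ Mx, IsMaximalSA (lowerBoundsSA M) Mx ∧ LoewnerLE L Mx := by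
    intro L hL
    obtain ⟨m, hLm, hm⟩ := zorn_le_nonempty₀ (lowerBoundsSA M)
      (fun c hcM hc y hy => chain_ub M hne hsa c hcM hc y hy) L hL
    refine ⟨m, ⟨hm.prop, fun X hX hmX => ?_⟩, (loewner_iff hL.1 hm.prop.1).2 hLm⟩
    have h := (loewner_iff hm.prop.1 hX.1).1 hmX
    exact le_antisymm (hm.le_of_ge hX h) h
  have h4 : ∀ G, IsGreatestSA (lowerBoundsSA M) G →
      {X | IsMaximalSA (lowerBoundsSA M) X} = {G} := by
    intro G hG
    ext X
    simp only [Set.mem_ofPred_eq, Set.mem_singleton_iff]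
    constructor
    · intro hX
      exact (hX.2 G hG.1 (hG.2 X hX.1)).symm
    · rintro rfl
      exact ⟨hG.1, fun Y hY h => hanti Y hY X hG.1 (hG.2 Y hY) h⟩
  refine ⟨h1, ?_, ⟨?_, fun ⟨G, hG⟩ => ⟨G, h4 G hG⟩⟩, h4⟩
  · obtain ⟨L, hL⟩ := hbdd
    obtain ⟨m, hm, _⟩ := h1 L hL
    exact ⟨m, hm⟩
  · rintro ⟨Mx, hMx⟩
    have hmem : IsMaximalSA (lowerBoundsSA M) Mx := by
      have : Mx ∈ {X | IsMaximalSA (lowerBoundsSA M) X} := by rw [hMx]; rfl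
      exact this
    refine ⟨Mx, hmem.1, fun X hX => ?_⟩
    obtain ⟨m, hm, hXm⟩ := h1 X hX
    have : m ∈ ({Mx} : Set (H →L[ℂ] H)) := by rw [← hMx]; exact hm
    rw [Set.mem_singleton_iff] at this
    exact this ▸ hXm
end
end

section
/- Let 𝓜 be a nonempty subset of 𝔖 bounded from below. (i) If there exist G ∈ 𝔖 and a dense subset 𝓓 of the unit sphere of 𝓗 such that (Gu,u) = inf{ (Au,u) : A ∈ 𝓜 } for every u ∈ 𝓓, then inf 𝓜 exists and equals G. (ii) If, additionally, 𝓜 is norm-bounded and inf 𝓜 exists, then ((inf 𝓜)u,u) = inf{ (Au,u) : A ∈ 𝓜 } for every u ∈ 𝓗. -/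
noncomputable section

variable {H : Type*} [NormedAddCommGroup H] [InnerProductSpace ℂ H] [CompleteSpace H]

lemma qform_add (S T : H →L[ℂ] H) (u : H) : qform (S + T) u = qform S u + qform T u := by
  simp [qform, inner_add_left]

lemma qform_sub (S T : H →L[ℂ] H) (u : H) : qform (S - T) u = qform S u - qform T u := by
  simp [qform, inner_sub_left]

lemma qform_rsmul (c : ℝ) (S : H →L[ℂ] H) (u : H) :
    qform ((c : ℂ) • S) u = c * qform S u := by
  simp [qform, inner_smul_left]

lemma qform_one (u : H) : qform (1 : H →L[ℂ] H) u = ‖u‖ ^ 2 := by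
  have := inner_self_eq_norm_sq (𝕜 := ℂ) u
  simpa [qform] using this

lemma qform_smul_vec (S : H →L[ℂ] H) (c : ℂ) (u : H) :
    qform S (c • u) = ‖c‖ ^ 2 * qform S u := by
  have h : (inner ℂ (S (c • u)) (c • u) : ℂ) = ((‖c‖ ^ 2 : ℝ) : ℂ) * inner ℂ (S u) u := by
    rw [map_smul, inner_smul_left, inner_smul_right, ← mul_assoc, Complex.conj_mul']
    push_cast; rfl
  unfold qform
  rw [h, Complex.re_ofReal_mul]

lemma qform_rankOne (u v : H) :
    qform ((innerSL ℂ u).smulRight u) v = ‖(inner ℂ u v : ℂ)‖ ^ 2 := by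
  have h : (inner ℂ (((innerSL ℂ u).smulRight u) v) v : ℂ)
      = ((‖(inner ℂ u v : ℂ)‖ ^ 2 : ℝ) : ℂ) := by
    simp only [ContinuousLinearMap.smulRight_apply, innerSL_apply_apply, inner_smul_left]
    rw [Complex.conj_mul']
    push_cast; rfl
  unfold qform
  rw [h, Complex.ofReal_re]

lemma isSelfAdjoint_rankOne (u : H) :
    IsSelfAdjoint ((innerSL ℂ u).smulRight u : H →L[ℂ] H) := by
  rw [ContinuousLinearMap.isSelfAdjoint_iff_isSymmetric]
  intro x y
  simp [inner_smul_left, inner_smul_right, mul_comm]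

lemma qform_parallelogram (S : H →L[ℂ] H) (x y : H) :
    qform S (x + y) + qform S (x - y) = 2 * qform S x + 2 * qform S y := by
  simp only [qform, map_add, map_sub, inner_add_left, inner_add_right, inner_sub_left,
    inner_sub_right, Complex.add_re, Complex.sub_re]
  ring

lemma qform_le_norm (S : H →L[ℂ] H) (u : H) : qform S u ≤ ‖S‖ * ‖u‖ ^ 2 := by
  unfold qform
  calc (inner ℂ (S u) u : ℂ).re ≤ ‖(inner ℂ (S u) u : ℂ)‖ := Complex.re_le_norm _
    _ ≤ ‖S u‖ * ‖u‖ := norm_inner_le_norm _ _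
    _ ≤ (‖S‖ * ‖u‖) * ‖u‖ := by gcongr; exact S.le_opNorm u
    _ = _ := by ring

lemma continuous_qform (S : H →L[ℂ] H) : Continuous (qform S) := by
  unfold qform
  exact Complex.continuous_re.comp (S.continuous.inner continuous_id)

lemma loewnerLE_of_dense (S T : H →L[ℂ] H) (D : Set H) (hD : {u : H | ‖u‖ = 1} ⊆ closure D)
    (h : ∀ u ∈ D, qform S u ≤ qform T u) : LoewnerLE S T := by
  have hs : ∀ u : H, ‖u‖ = 1 → qform S u ≤ qform T u := by
    intro u hu
    have hc : IsClosed {u : H | qform S u ≤ qform T u} :=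
      isClosed_le (continuous_qform S) (continuous_qform T)
    exact closure_minimal h hc (hD hu)
  intro u
  by_cases hu : u = 0
  · simp [hu, qform]
  have hn : ‖u‖ ≠ 0 := norm_ne_zero_iff.mpr hu
  have h1 : ‖((‖u‖ : ℂ)⁻¹) • u‖ = 1 := by
    rw [norm_smul, norm_inv, Complex.norm_real, norm_norm, inv_mul_cancel₀ hn]
  have h2 := hs _ h1
  rw [qform_smul_vec, qform_smul_vec] at h2
  have h3 : 0 < ‖((‖u‖ : ℂ)⁻¹)‖ ^ 2 := by
    rw [norm_inv, Complex.norm_real, norm_norm]; positivity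
  exact le_of_mul_le_mul_left h2 h3

/-- Theorem 3.3: (i) if `G ∈ 𝔖` realizes the pointwise quadratic-form infimum on a dense
subset of the unit sphere, then `G` is the greatest lower bound of `M`; (ii) if moreover `M`
is norm-bounded and the greatest lower bound exists, it realizes the pointwise infimum
everywhere. -/
theorem stmt4 (M : Set (H →L[ℂ] H)) (hne : M.Nonempty)
    (hsa : ∀ A ∈ M, IsSelfAdjoint A)
    (hbdd : (lowerBoundsSA M).Nonempty) :
    (∀ G : H →L[ℂ] H, IsSelfAdjoint G →
      (∃ D : Set H, D ⊆ {u : H | ‖u‖ = 1} ∧ {u : H | ‖u‖ = 1} ⊆ closure D ∧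
        ∀ u ∈ D, qform G u = sInf ((fun A => qform A u) '' M)) →
      IsGreatestSA (lowerBoundsSA M) G) ∧
    ((∃ C : ℝ, ∀ A ∈ M, ‖A‖ ≤ C) →
      ∀ G, IsGreatestSA (lowerBoundsSA M) G →
        ∀ u : H, qform G u = sInf ((fun A => qform A u) '' M)) := by
  have bdd : ∀ u : H, BddBelow ((fun A => qform A u) '' M) := by
    intro u
    obtain ⟨L, -, hL⟩ := hbdd
    refine ⟨qform L u, ?_⟩
    rintro _ ⟨A, hA, rfl⟩
    exact hL A hA u
  refine ⟨?_, ?_⟩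
  · rintro G hG ⟨D, -, hD, hGD⟩
    refine ⟨⟨hG, fun A hA => ?_⟩, fun X hX => ?_⟩
    · refine loewnerLE_of_dense _ _ D hD fun u hu => ?_
      rw [hGD u hu]
      exact csInf_le (bdd u) ⟨A, hA, rfl⟩
    · refine loewnerLE_of_dense _ _ D hD fun u hu => ?_
      rw [hGD u hu]
      refine le_csInf (hne.image _) ?_
      rintro _ ⟨A, hA, rfl⟩
      exact hX.2 A hA u
  · rintro ⟨C, hC⟩ G ⟨⟨hG, hGM⟩, hmax⟩ u
    refine le_antisymm ?_ ?_
    · refine le_csInf (hne.image _) ?_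
      rintro _ ⟨A, hA, rfl⟩
      exact hGM A hA u
    by_contra! hlt
    obtain ⟨δ, hδ⟩ : ∃ δ, δ = sInf ((fun A => qform A u) '' M) - qform G u := ⟨_, rfl⟩
    have hδ0 : 0 < δ := by rw [hδ]; linarith
    have hA : ∀ A ∈ M, δ ≤ qform (A - G) u := by
      intro A hA
      have : sInf ((fun A => qform A u) '' M) ≤ qform A u := csInf_le (bdd u) ⟨A, hA, rfl⟩
      rw [qform_sub, hδ]; linarith
    have hu : u ≠ 0 := by
      rintro rfl
      obtain ⟨A, hAM⟩ := hne
      have := hA A hAM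
      simp [qform] at this
      linarith
    have hn : 0 < ‖u‖ ^ 2 := by positivity
    obtain ⟨n, hnd⟩ : ∃ n, n = ‖u‖ ^ 2 := ⟨_, rfl⟩
    rw [← hnd] at hn
    obtain ⟨K, hK⟩ : ∃ K, K = C + ‖G‖ := ⟨_, rfl⟩
    let R : H →L[ℂ] H := (innerSL ℂ u).smulRight u
    let L : H →L[ℂ] H := G + ((δ / 2 / n ^ 2 + K / n : ℝ) : ℂ) • R - ((K : ℝ) : ℂ) • 1
    have hqL : ∀ v, qform L v = qform G v +
        (δ / 2 / n ^ 2 + K / n) * ‖(inner ℂ u v : ℂ)‖ ^ 2 - K * ‖v‖ ^ 2 := by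
      intro v
      simp only [L, R]
      rw [qform_sub, qform_add, qform_rsmul, qform_rsmul, qform_one, qform_rankOne]
    have hLsa : IsSelfAdjoint L := by
      have hr : ∀ c : ℝ, IsSelfAdjoint (c : ℂ) := fun c => Complex.conj_ofReal c
      exact (hG.add ((hr _).smul (isSelfAdjoint_rankOne u))).sub ((hr _).smul (.one _))
    have hLl : L ∈ lowerBoundsSA M := by
      refine ⟨hLsa, fun A hAM v => ?_⟩
      rw [hqL]
      obtain ⟨a, ha⟩ : ∃ a : ℂ, a = inner ℂ u v / (n : ℂ) := ⟨_, rfl⟩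
      have hnc : (n : ℂ) ≠ 0 := by exact_mod_cast hn.ne'
      have huu : (inner ℂ u u : ℂ) = (n : ℂ) := by
        rw [inner_self_eq_norm_sq_to_K, hnd]; push_cast; rfl
      have hin : (inner ℂ u v : ℂ) = a * n := by rw [ha]; field_simp
      have hnin : ‖(inner ℂ u v : ℂ)‖ ^ 2 = ‖a‖ ^ 2 * n ^ 2 := by
        rw [hin, norm_mul, Complex.norm_real, mul_pow, Real.norm_eq_abs, sq_abs]
      have horth : (inner ℂ (a • u) (v - a • u) : ℂ) = 0 := by
        rw [inner_smul_left, inner_sub_right, inner_smul_right, huu, hin]; simp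
      have hpy : ‖v‖ ^ 2 = ‖a‖ ^ 2 * n + ‖v - a • u‖ ^ 2 := by
        have := norm_add_sq_eq_norm_sq_add_norm_sq_of_inner_eq_zero (a • u) (v - a • u) horth
        rw [add_sub_cancel, norm_smul] at this
        rw [hnd]; nlinarith
      have hpar := qform_parallelogram (A - G) v (v - a • u)
      rw [sub_sub_cancel, qform_smul_vec] at hpar
      have hpos : 0 ≤ qform (A - G) (v + (v - a • u)) := by
        rw [qform_sub]; linarith [hGM A hAM (v + (v - a • u))]
      have hnorm : ‖A - G‖ ≤ K := by
        rw [hK]; exact (norm_sub_le _ _).trans (by linarith [hC A hAM])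
      have hw : qform (A - G) (v - a • u) ≤ K * ‖v - a • u‖ ^ 2 :=
        (qform_le_norm _ _).trans (by gcongr)
      have hau : ‖a‖ ^ 2 * δ ≤ ‖a‖ ^ 2 * qform (A - G) u := by
        gcongr; exact hA A hAM
      have hv := qform_sub A G v
      have e : (δ / 2 / n ^ 2 + K / n) * (‖a‖ ^ 2 * n ^ 2) =
          ‖a‖ ^ 2 * δ / 2 + K * (‖a‖ ^ 2 * n) := by field_simp
      rw [hnin, e, hpy]
      nlinarith
    have hfin := hmax L hLl u
    rw [hqL] at hfin
    have huu : ‖(inner ℂ u u : ℂ)‖ ^ 2 = n ^ 2 := by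
      rw [inner_self_eq_norm_sq_to_K, hnd]; simp
    rw [huu, ← hnd] at hfin
    have e : (δ / 2 / n ^ 2 + K / n) * n ^ 2 = δ / 2 + K * n := by field_simp
    rw [e] at hfin
    linarith
end
end

section
/- Let A, B ∈ 𝔖 and let T be a bounded linear operator on 𝓗 which is boundedly invertible. Then the operator M_T := ½ ( A + B − T* |(T*)⁻¹ (A−B) T⁻¹| T ) is a maximal lower bound of the set {A, B}. -/
set_option synthInstance.maxHeartbeats 400000
set_option maxHeartbeats 800000

noncomputable section

variable {H : Type*} [NormedAddCommGroup H] [InnerProductSpace ℂ H] [CompleteSpace H]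

/-- The modulus `|S| = (S*S)^{1/2}` of a bounded operator `S`. -/
def absOp (S : H →L[ℂ] H) : H →L[ℂ] H := CFC.sqrt (ContinuousLinearMap.adjoint S * S)

theorem mul_eq_zero_of_conj (Z N : H →L[ℂ] H) (hZ : 0 ≤ Z) (h : star N * Z * N ≤ 0) :
    Z * N = 0 := by
  have h0 : star N * Z * N = 0 := le_antisymm h (star_left_conjugate_nonneg hZ N)
  have hs : CFC.sqrt Z * CFC.sqrt Z = Z := CFC.sqrt_mul_sqrt_self Z hZ
  have hsa : star (CFC.sqrt Z) = CFC.sqrt Z :=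
    (IsSelfAdjoint.of_nonneg (CFC.sqrt_nonneg Z)).star_eq
  have h1 : star (CFC.sqrt Z * N) * (CFC.sqrt Z * N) = 0 := by
    rw [star_mul, hsa, ← h0]
    nth_rewrite 3 [← hs]
    simp only [mul_assoc]
  have h2 : CFC.sqrt Z * N = 0 := (CStarRing.star_mul_self_eq_zero_iff _).1 h1
  rw [← hs, mul_assoc, h2, mul_zero]

theorem eq_zero_of_le_of_le (P N Z : H →L[ℂ] H) (hZ : 0 ≤ Z) (hP : Z ≤ P) (hN : Z ≤ N)
    (h : P * N = 0) : Z = 0 := by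
  have hNs : star N = N := (IsSelfAdjoint.of_nonneg (hZ.trans hN)).star_eq
  have hZs : star Z = Z := (IsSelfAdjoint.of_nonneg hZ).star_eq
  have h1 : Z * N = 0 := by
    apply mul_eq_zero_of_conj Z N hZ
    have := star_left_conjugate_le_conjugate hP N
    rwa [mul_assoc (star N) P N, h, mul_zero] at this
  have h2 : Z * Z = 0 := by
    apply mul_eq_zero_of_conj Z Z hZ
    have := star_left_conjugate_le_conjugate hN Z
    rw [hZs, h1, zero_mul] at this
    rwa [hZs]
  apply (CStarRing.star_mul_self_eq_zero_iff _).1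
  rw [hZs, h2]

theorem loewnerLE_iff (S T : H →L[ℂ] H) (hS : IsSelfAdjoint S) (hT : IsSelfAdjoint T) :
    LoewnerLE S T ↔ S ≤ T := by
  rw [ContinuousLinearMap.le_def, ContinuousLinearMap.isPositive_def']
  simp only [hT.sub hS, true_and, ContinuousLinearMap.reApplyInnerSelf,
    sub_apply, inner_sub_left, map_sub, sub_nonneg]
  rfl

/-- Theorem 5.1: for self-adjoint `A, B` and any bounded, boundedly invertible `T`, the
operator `M_T = ½ (A + B - T* |(T*)⁻¹ (A - B) T⁻¹| T)` is a maximal lower bound of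
`{A, B}`. -/
theorem stmt13 (A B : H →L[ℂ] H) (hA : IsSelfAdjoint A) (hB : IsSelfAdjoint B)
    (T Tinv : H →L[ℂ] H) (hT : T * Tinv = 1) (hT' : Tinv * T = 1) :
    IsMaximalSA (lowerBoundsSA {A, B})
      ((1 / 2 : ℝ) •
        (A + B - ContinuousLinearMap.adjoint T *
          absOp (ContinuousLinearMap.adjoint Tinv * (A - B) * Tinv) * T)) := by
  have hC : IsSelfAdjoint (ContinuousLinearMap.adjoint Tinv * (A - B) * Tinv) := by
    rw [← ContinuousLinearMap.star_eq_adjoint]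
    exact (hA.sub hB).conjugate' Tinv
  have habs : absOp (ContinuousLinearMap.adjoint Tinv * (A - B) * Tinv)
      = CFC.abs (ContinuousLinearMap.adjoint Tinv * (A - B) * Tinv) := rfl
  rw [habs, ← CFC.posPart_add_negPart _ hC]
  have hsub := CFC.posPart_sub_negPart _ hC
  have hP := CFC.posPart_nonneg (ContinuousLinearMap.adjoint Tinv * (A - B) * Tinv)
  have hN := CFC.negPart_nonneg (ContinuousLinearMap.adjoint Tinv * (A - B) * Tinv)
  have hPN := CFC.posPart_mul_negPart (ContinuousLinearMap.adjoint Tinv * (A - B) * Tinv)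
  generalize (ContinuousLinearMap.adjoint Tinv * (A - B) * Tinv)⁺ = P at *
  generalize (ContinuousLinearMap.adjoint Tinv * (A - B) * Tinv)⁻ = N at *
  simp only [← ContinuousLinearMap.star_eq_adjoint] at *
  have hTs : star Tinv * star T = 1 := by rw [← star_mul, hT, star_one]
  have hTs' : star T * star Tinv = 1 := by rw [← star_mul, hT', star_one]
  have hAB : A - B = star T * P * T - star T * N * T := by
    rw [← sub_mul, ← mul_sub, hsub]
    calc A - B = (star T * star Tinv) * (A - B) * (Tinv * T) := by rw [hTs', hT']; simp
      _ = _ := by simp only [mul_assoc]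
  have hconj : ∀ Q : H →L[ℂ] H, star Tinv * (star T * Q * T) * Tinv = Q := fun Q => by
    calc _ = (star Tinv * star T) * Q * (T * Tinv) := by simp only [mul_assoc]
      _ = Q := by rw [hTs, hT]; simp
  have hMA : (1 / 2 : ℝ) • (A + B - star T * (P + N) * T) = A - star T * P * T := by
    have : A + B - star T * (P + N) * T = (2 : ℝ) • (A - star T * P * T) := by
      rw [two_smul, mul_add, add_mul]
      have : B = A - (star T * P * T - star T * N * T) := by rw [← hAB]; abel
      rw [this]; abel
    rw [this, smul_smul]; norm_num
  rw [hMA]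
  have hMB : A - star T * P * T = B - star T * N * T := by
    rw [sub_eq_sub_iff_sub_eq_sub]; exact hAB
  have hP' : 0 ≤ star T * P * T := star_left_conjugate_nonneg hP T
  have hN' : 0 ≤ star T * N * T := star_left_conjugate_nonneg hN T
  have hM : IsSelfAdjoint (A - star T * P * T) := hA.sub (IsSelfAdjoint.of_nonneg hP')
  refine ⟨⟨hM, ?_⟩, ?_⟩
  · rintro D (rfl | rfl)
    · rw [loewnerLE_iff _ _ hM hA]
      exact sub_le_self _ hP'
    · rw [loewnerLE_iff _ _ hM hB, hMB]
      exact sub_le_self _ hN'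
  · rintro X ⟨hX, hXl⟩ hMX
    have hXA := (loewnerLE_iff _ _ hX hA).1 (hXl A (by simp))
    have hXB := (loewnerLE_iff _ _ hX hB).1 (hXl B (by simp))
    rw [loewnerLE_iff _ _ hM hX] at hMX
    have hY : 0 ≤ X - (A - star T * P * T) := sub_nonneg.2 hMX
    have hYP : X - (A - star T * P * T) ≤ star T * P * T := by
      have := sub_le_sub_right hXA (A - star T * P * T)
      rwa [sub_sub_cancel] at this
    have hYN : X - (A - star T * P * T) ≤ star T * N * T := by
      have := sub_le_sub_right hXB (B - star T * N * T)
      rwa [sub_sub_cancel, ← hMB] at this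
    generalize hYeq : X - (A - star T * P * T) = Y at hY hYP hYN
    have hZ0 : star Tinv * Y * Tinv = 0 := by
      apply eq_zero_of_le_of_le P N _ (star_left_conjugate_nonneg hY Tinv) _ _ hPN
      · have := star_left_conjugate_le_conjugate hYP Tinv
        rwa [hconj] at this
      · have := star_left_conjugate_le_conjugate hYN Tinv
        rwa [hconj] at this
    have hY0 : Y = 0 := by
      calc Y = (star T * star Tinv) * Y * (Tinv * T) := by rw [hTs', hT']; simp
        _ = star T * (star Tinv * Y * Tinv) * T := by simp only [mul_assoc]
        _ = 0 := by rw [hZ0]; simp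
    exact sub_eq_zero.1 (hYeq.trans hY0)
end
end
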